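/- Let X = X_u × X_n with nominal structure R₀, Q₀, and U : X → ℝ. Suppose ζ ↦ h_ζ ∈ ℝ^X and ζ ↦ η(ζ) ∈ ℝ are differentiable at ζ₀ and satisfy the fixed-point equation ζ U(x) + Λ_{h_ζ}(x) = h_ζ(x) + η(ζ) for all x ∈ X and all ζ in a neighborhood of ζ₀. Then H := (d/dζ) h_ζ |_{ζ₀} solves Poisson's equation U(x) + Σ_{x'} \check{P}(x,x') H(x') = H(x) + η'(ζ₀) for all x, where \check{P} = P_{h_{ζ₀}}; moreover, if \check{π} is an invariant pmf for \check{P}, then η'(ζ₀) = Σ_x \check{π}(x) U(x). -/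

import Mathlib

/-- Conditional average `h(xu'∣x) = ∑_{xn'} Q₀(x,xn') h(xu',xn')`. -/
noncomputable def condAvg {Xu Xn : Type*} [Fintype Xn]
    (Q₀ : (Xu × Xn) → Xn → ℝ) (h : Xu × Xn → ℝ) (x : Xu × Xn) (xu' : Xu) : ℝ :=
  ∑ xn', Q₀ x xn' * h (xu', xn')

/-- Log-partition function `Λ_h(x) = log ∑_{xu'} R₀(x,xu') exp(h(xu'∣x))`. -/
noncomputable def logPart {Xu Xn : Type*} [Fintype Xu] [Fintype Xn]
    (R₀ : (Xu × Xn) → Xu → ℝ) (Q₀ : (Xu × Xn) → Xn → ℝ)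
    (h : Xu × Xn → ℝ) (x : Xu × Xn) : ℝ :=
  Real.log (∑ xu', R₀ x xu' * Real.exp (condAvg Q₀ h x xu'))

/-- Tilted matrix `P_h(x,(xu',xn')) = R₀(x,xu') exp(h(xu'∣x) − Λ_h(x)) Q₀(x,xn')`. -/
noncomputable def tilt {Xu Xn : Type*} [Fintype Xu] [Fintype Xn]
    (R₀ : (Xu × Xn) → Xu → ℝ) (Q₀ : (Xu × Xn) → Xn → ℝ)
    (h : Xu × Xn → ℝ) (x x' : Xu × Xn) : ℝ :=
  R₀ x x'.1 * Real.exp (condAvg Q₀ h x x'.1 - logPart R₀ Q₀ h x) * Q₀ x x'.2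

theorem condAvg_hasDerivAt {Xu Xn : Type*} [Fintype Xn]
    (Q₀ : (Xu × Xn) → Xn → ℝ) {h : ℝ → (Xu × Xn) → ℝ} {H : Xu × Xn → ℝ} {ζ₀ : ℝ}
    (hdiff : ∀ x, HasDerivAt (fun ζ : ℝ => h ζ x) (H x) ζ₀) (x : Xu × Xn) (xu' : Xu) :
    HasDerivAt (fun ζ => condAvg Q₀ (h ζ) x xu') (condAvg Q₀ H x xu') ζ₀ :=
  HasDerivAt.fun_sum fun xn' _ => (hdiff (xu', xn')).const_mul (Q₀ x xn')

theorem partition_pos {Xu Xn : Type*} [Fintype Xu] [Fintype Xn] [Nonempty Xu]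
    {R₀ : (Xu × Xn) → Xu → ℝ} (hR₀pos : ∀ x xu', 0 < R₀ x xu')
    (Q₀ : (Xu × Xn) → Xn → ℝ) (h : Xu × Xn → ℝ) (x : Xu × Xn) :
    0 < ∑ xu', R₀ x xu' * Real.exp (condAvg Q₀ h x xu') :=
  Finset.sum_pos (fun xu' _ => mul_pos (hR₀pos x xu') (Real.exp_pos _)) Finset.univ_nonempty

theorem sum_tilt_mul {Xu Xn : Type*} [Fintype Xu] [Fintype Xn] [Nonempty Xu]
    {R₀ : (Xu × Xn) → Xu → ℝ} (hR₀pos : ∀ x xu', 0 < R₀ x xu')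
    (Q₀ : (Xu × Xn) → Xn → ℝ) (h H : Xu × Xn → ℝ) (x : Xu × Xn) :
    ∑ x', tilt R₀ Q₀ h x x' * H x' =
      (∑ xu', R₀ x xu' * (Real.exp (condAvg Q₀ h x xu') * condAvg Q₀ H x xu')) /
        ∑ xu', R₀ x xu' * Real.exp (condAvg Q₀ h x xu') := by
  rw [Fintype.sum_prod_type, Finset.sum_div]
  refine Finset.sum_congr rfl fun xu' _ => ?_
  simp only [tilt, Real.exp_sub, logPart, Real.exp_log (partition_pos hR₀pos Q₀ h x)]
  rw [condAvg.eq_def Q₀ H, Finset.mul_sum, Finset.mul_sum, Finset.sum_div]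
  exact Finset.sum_congr rfl fun xn' _ => by ring

theorem logPart_hasDerivAt {Xu Xn : Type*} [Fintype Xu] [Fintype Xn] [Nonempty Xu]
    {R₀ : (Xu × Xn) → Xu → ℝ} (hR₀pos : ∀ x xu', 0 < R₀ x xu')
    (Q₀ : (Xu × Xn) → Xn → ℝ) {h : ℝ → (Xu × Xn) → ℝ} {H : Xu × Xn → ℝ} {ζ₀ : ℝ}
    (hdiff : ∀ x, HasDerivAt (fun ζ : ℝ => h ζ x) (H x) ζ₀) (x : Xu × Xn) :
    HasDerivAt (fun ζ => logPart R₀ Q₀ (h ζ) x) (∑ x', tilt R₀ Q₀ (h ζ₀) x x' * H x') ζ₀ := by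
  rw [sum_tilt_mul hR₀pos]
  exact (HasDerivAt.fun_sum fun xu' _ =>
    ((condAvg_hasDerivAt Q₀ hdiff x xu').exp.const_mul (R₀ x xu'))).log
      (partition_pos hR₀pos Q₀ (h ζ₀) x).ne'

/-- If `ζ ↦ h_ζ` and `ζ ↦ η(ζ)` are differentiable at `ζ₀` and
satisfy the fixed-point equation `ζU(x) + Λ_{h_ζ}(x) = h_ζ(x) + η(ζ)` for all
`x` and all `ζ` near `ζ₀`, then `H = (d/dζ) h_ζ |_{ζ₀}` solves Poisson's
equation `U(x) + ∑_{x'} P̌(x,x') H(x') = H(x) + η'(ζ₀)` with `P̌ = P_{h_{ζ₀}}`;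
moreover, if `π̌` is an invariant pmf for `P̌`, then
`η'(ζ₀) = ∑_x π̌(x) U(x)`. -/
theorem fixed_point_derivative_poisson
    {Xu Xn : Type*} [Fintype Xu] [Fintype Xn] [Nonempty Xu] [Nonempty Xn]
    (R₀ : (Xu × Xn) → Xu → ℝ)
    (hR₀pos : ∀ x xu', 0 < R₀ x xu') (hR₀sum : ∀ x, ∑ xu', R₀ x xu' = 1)
    (Q₀ : (Xu × Xn) → Xn → ℝ)
    (hQ₀ : ∀ x xn', 0 ≤ Q₀ x xn') (hQ₀sum : ∀ x, ∑ xn', Q₀ x xn' = 1)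
    (U : Xu × Xn → ℝ)
    (h : ℝ → (Xu × Xn) → ℝ) (η : ℝ → ℝ) (ζ₀ η' : ℝ) (H : Xu × Xn → ℝ)
    (hdiff : ∀ x, HasDerivAt (fun ζ : ℝ => h ζ x) (H x) ζ₀)
    (ηdiff : HasDerivAt η η' ζ₀)
    (hfix : ∀ᶠ ζ in nhds ζ₀, ∀ x, ζ * U x + logPart R₀ Q₀ (h ζ) x = h ζ x + η ζ) :
    (∀ x, U x + ∑ x', tilt R₀ Q₀ (h ζ₀) x x' * H x' = H x + η') ∧
    (∀ π : (Xu × Xn) → ℝ, (∀ x, 0 ≤ π x) → (∑ x, π x = 1) →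
      (∀ x', ∑ x, π x * tilt R₀ Q₀ (h ζ₀) x x' = π x') →
      η' = ∑ x, π x * U x) := by
  have poisson : ∀ x, U x + ∑ x', tilt R₀ Q₀ (h ζ₀) x x' * H x' = H x + η' := fun x => by
    have hl := ((hasDerivAt_id ζ₀).mul_const (U x)).add (logPart_hasDerivAt hR₀pos Q₀ hdiff x)
    have hr := (hdiff x).add ηdiff
    rw [one_mul] at hl
    exact hl.unique (hr.congr_of_eventuallyEq (hfix.mono fun ζ hζ => hζ x))
  refine ⟨poisson, fun π _ hsum hinv => ?_⟩
  have key : ∑ x, π x * ∑ x', tilt R₀ Q₀ (h ζ₀) x x' * H x' = ∑ x, π x * H x := by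
    simp_rw [Finset.mul_sum]
    rw [Finset.sum_comm]
    refine Finset.sum_congr rfl fun x' _ => ?_
    rw [← hinv x', Finset.sum_mul]
    exact Finset.sum_congr rfl fun x _ => by ring
  have havg : ∑ x, π x * (U x + ∑ x', tilt R₀ Q₀ (h ζ₀) x x' * H x') =
      ∑ x, π x * (H x + η') :=
    Finset.sum_congr rfl fun x _ => by rw [poisson x]
  simp only [mul_add, Finset.sum_add_distrib] at havg
  rw [key, ← Finset.sum_mul, hsum] at havg
  linarith
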